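/- There exist n₀ ∈ ℕ and constants c, c′ > 0 with the following property. Let f be a centered continuous stationary Gaussian process on ℝ whose spectral measure μ is supported on [−1/2, 1/2] \ (−1/4, 1/4) (i.e., μ vanishes outside [−1/2, 1/2] and on (−1/4, 1/4)). Then for every integer n ≥ n₀ there exist a number σ ∈ [0, √(μ(ℝ))] and nonnegative reals β₀, β₁, …, β_n with Σ_{k=0}^n β_k = 1 such that: (i) E[(Σ_{k=0}^n β_k f(k))²] ≤ e^{−6cn} σ²; and (ii) for every deterministic function φ : ℝ → ℝ, the probability of the event that f(k) + φ(k) ≥ 0 for every k ∈ {0, …, n} with β_k > 0 and simultaneously Σ_{k=0}^n β_k (f(k) + φ(k)) ≤ e^{−cn} σ, is at most e^{−c′n²}. -/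

import Mathlib

open MeasureTheory ProbabilityTheory Real
open scoped NNReal

theorem exists_orthogonal_sub_sum {E : Type*} [NormedAddCommGroup E] [InnerProductSpace ℝ E]
    {J : ℕ} (v : Fin J → E) (x : E) :
    ∃ a : Fin J → ℝ, ∀ k, inner ℝ (x - ∑ i, a i • v i) (v k) = 0 := by
  set K := Submodule.span ℝ (Set.range v)
  have : FiniteDimensional ℝ K := FiniteDimensional.span_of_finite ℝ (Set.finite_range v)
  obtain ⟨a, ha⟩ := (Submodule.mem_span_range_iff_exists_fun ℝ).1 (K.starProjection_apply_mem x)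
  refine ⟨a, fun k => ?_⟩
  rw [ha]
  exact K.starProjection_inner_eq_zero x (v k) (Submodule.subset_span ⟨k, rfl⟩)

theorem exists_integral_sub_sum_mul_eq_zero {Ω : Type*} {mΩ : MeasurableSpace Ω} {P : Measure Ω}
    {X : ℕ → Ω → ℝ} (hX : ∀ i, MemLp (X i) 2 P) (J : ℕ) :
    ∃ a : Fin J → ℝ, ∀ k : Fin J,
      ∫ ω, (X J ω - ∑ i, a i * X i ω) * X k ω ∂P = 0 := by
  obtain ⟨a, ha⟩ := exists_orthogonal_sub_sum (fun i : Fin J => (hX i).toLp) (hX J).toLp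
  refine ⟨a, fun k => ?_⟩
  rw [← ha k, L2.inner_def]
  refine integral_congr_ae ?_
  have h1 : ∀ᵐ ω ∂P, ∀ i : Fin J, ((hX i).toLp : Lp ℝ 2 P) ω = X i ω :=
    ae_all_iff.2 fun i => (hX i).coeFn_toLp
  have h2 : ∀ᵐ ω ∂P, ∀ i : Fin J, (a i • (hX i).toLp : Lp ℝ 2 P) ω = a i * ((hX i).toLp : Lp ℝ 2 P) ω :=
    ae_all_iff.2 fun i => Lp.coeFn_smul _ _
  filter_upwards [h1, h2, (hX J).coeFn_toLp, Lp.coeFn_sub (hX J).toLp (∑ i, a i • (hX i).toLp),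
    Lp.coeFn_finsetSum Finset.univ (fun i : Fin J => (a i • (hX i).toLp : Lp ℝ 2 P))]
    with ω h1 h2 h3 h4 h5
  simp only [h1 k, h4, Pi.sub_apply, h3, h5, Finset.sum_apply, h2, h1]
  simp [mul_comm]

theorem exists_forall_integral_sub_sum_sq_le {Ω : Type*} {mΩ : MeasurableSpace Ω} {P : Measure Ω}
    {X : ℕ → Ω → ℝ} (hX : ∀ i, MemLp (X i) 2 P) (J : ℕ) :
    ∃ a : Fin J → ℝ, ∀ b : Fin J → ℝ,
      ∫ ω, (X J ω - ∑ i, a i * X i ω) ^ 2 ∂P ≤ ∫ ω, (X J ω - ∑ i, b i * X i ω) ^ 2 ∂P := by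
  obtain ⟨a, ha⟩ := exists_integral_sub_sum_mul_eq_zero hX J
  refine ⟨a, fun b => ?_⟩
  have hLp : ∀ c : Fin J → ℝ, MemLp (fun ω => X J ω - ∑ i, c i * X i ω) 2 P := fun c =>
    (hX J).sub (memLp_finsetSum _ fun i _ => (hX i).const_mul _)
  have hI : ∀ k : Fin J, Integrable (fun ω => (X J ω - ∑ i, a i * X i ω) * X k ω) P :=
    fun k => (hLp a).integrable_mul (hX k)
  have h0 : ∫ ω, ∑ k, 2 * (a k - b k) * ((X J ω - ∑ i, a i * X i ω) * X k ω) ∂P = 0 := by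
    rw [integral_finsetSum _ fun k _ => (hI k).const_mul _]
    simp [integral_const_mul, ha]
  rw [← add_zero (∫ ω, (X J ω - ∑ i, a i * X i ω) ^ 2 ∂P), ← h0,
    ← integral_add (hLp a).integrable_sq (integrable_finsetSum _ fun k _ => (hI k).const_mul _)]
  refine integral_mono ((hLp a).integrable_sq.add
    (integrable_finsetSum _ fun k _ => (hI k).const_mul _)) (hLp b).integrable_sq fun ω => ?_
  have h1 : ∑ k, 2 * (a k - b k) * ((X J ω - ∑ i, a i * X i ω) * X k ω) =
      2 * (X J ω - ∑ i, a i * X i ω) * (∑ i, a i * X i ω - ∑ i, b i * X i ω) := by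
    rw [← Finset.sum_sub_distrib, Finset.mul_sum]
    exact Finset.sum_congr rfl fun k _ => by ring
  simp only [h1]
  nlinarith [sq_nonneg (∑ i, a i * X i ω - ∑ i, b i * X i ω)]

theorem gaussianReal_Icc_le {v : ℝ≥0} {s : ℝ} (hs : 0 < s) (hv : s ^ 2 ≤ v) (m a b : ℝ) :
    gaussianReal m v (Set.Icc a b) ≤ ENNReal.ofReal ((b - a) / s) := by
  have hv0 : 0 < (v : ℝ) := (by positivity : 0 < s ^ 2).trans_le hv
  have hv' : v ≠ 0 := by rintro rfl; simp at hv0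
  rw [gaussianReal_apply _ hv']
  calc ∫⁻ x in Set.Icc a b, gaussianPDF m v x
      ≤ ∫⁻ _ in Set.Icc a b, ENNReal.ofReal (1 / s) := by
        refine lintegral_mono fun x => ENNReal.ofReal_le_ofReal ?_
        rw [gaussianPDFReal]
        have h1 : s ≤ √(2 * π * v) := by
          apply Real.le_sqrt_of_sq_le
          nlinarith [Real.pi_gt_three]
        have h2 : rexp (-(x - m) ^ 2 / (2 * v)) ≤ 1 := by
          rw [Real.exp_le_one_iff]
          apply div_nonpos_of_nonpos_of_nonneg <;> nlinarith [sq_nonneg (x - m)]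
        calc _ ≤ (√(2 * π * v))⁻¹ * 1 := by gcongr
          _ ≤ 1 / s := by rw [mul_one, one_div]; gcongr
    _ = ENNReal.ofReal ((b - a) / s) := by
        rw [setLIntegral_const, Real.volume_Icc, ← ENNReal.ofReal_mul (by positivity)]
        congr 1; ring

theorem measure_forall_mem_Icc_le {Ω : Type*} {mΩ : MeasurableSpace Ω} {P : Measure Ω}
    [IsProbabilityMeasure P] {X : ℕ → Ω → ℝ} (hm : ∀ i, Measurable (X i))
    (hG : ∀ (m : ℕ) (a : Fin m → ℝ), ∃ v : ℝ≥0,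
      P.map (fun ω => ∑ i, a i * X i ω) = gaussianReal 0 v)
    {σ w : ℝ} (hσ : 0 < σ) {N : ℕ}
    (hX : ∀ j < N, ∀ a : Fin j → ℝ, σ ^ 2 ≤ ∫ ω, (X j ω - ∑ i, a i * X i ω) ^ 2 ∂P)
    (u : ℕ → ℝ) :
    P {ω | ∀ j < N, X j ω ∈ Set.Icc (u j) (u j + w)} ≤ ENNReal.ofReal (w / σ) ^ N := by
  have hlaw : ∀ j, HasGaussianLaw (fun ω (i : Fin j) => X i ω) P := fun j => by
    refine ⟨isGaussian_of_map_eq_gaussianReal fun L => ?_⟩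
    obtain ⟨v, hv⟩ := hG j fun i => L (Pi.single i 1)
    refine ⟨0, v, ?_⟩
    rw [← hv, Measure.map_map (by fun_prop) (by fun_prop)]
    congr 1
    ext ω
    rw [Function.comp_apply]
    conv_lhs => rw [← LinearMap.sum_single_apply (fun _ => ℝ) (fun i : Fin j => X i ω), map_sum]
    refine Finset.sum_congr rfl fun i _ => ?_
    rw [mul_comm, ← smul_eq_mul, ← map_smul, ← Pi.single_smul]
    simp
  have hLp : ∀ i, MemLp (X i) 2 P := fun i =>
    ((hlaw (i + 1)).eval (Fin.last i)).memLp_two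
  have hX_mean : ∀ i, ∫ ω, X i ω ∂P = 0 := fun i => by
    obtain ⟨v, hv⟩ := hG (i + 1) fun k => if k = Fin.last i then 1 else 0
    have := integral_id_gaussianReal (μ := 0) (v := v)
    rw [← hv, integral_map (by fun_prop) (by fun_prop)] at this
    simpa using this
  induction N with
  | zero => simp
  | succ N ih =>
    obtain ⟨a, ha⟩ := exists_integral_sub_sum_mul_eq_zero hLp N
    set Y : Ω → ℝ := fun ω => X N ω - ∑ i, a i * X i ω with hY
    have hYm : Measurable Y := by fun_prop
    obtain ⟨v, hv⟩ : ∃ v : ℝ≥0, P.map Y = gaussianReal 0 v := by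
      obtain ⟨v, hv⟩ := hG (N + 1) (Fin.snoc (fun i => - a i) 1)
      refine ⟨v, ?_⟩
      rw [← hv]
      congr 1
      ext ω
      simp [Fin.sum_univ_castSucc, hY]
      ring
    have hYint : ∫ ω, Y ω ∂P = 0 := by
      have := integral_id_gaussianReal (μ := 0) (v := v)
      rwa [← hv, integral_map (by fun_prop) (by fun_prop)] at this
    have hYLp : MemLp Y 2 P := (hLp N).sub (memLp_finsetSum _ fun i _ => (hLp i).const_mul _)
    have hvar : σ ^ 2 ≤ v := by
      refine (hX N (by omega) a).trans_eq ?_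
      rw [← variance_id_gaussianReal (μ := 0) (v := v), ← hv, variance_id_map (by fun_prop),
        variance_of_integral_eq_zero (by fun_prop) hYint]
    have hpair : HasGaussianLaw (fun ω => (fun i : Fin N => X i ω, fun _ : Unit => Y ω)) P := by
      let L : (Fin (N + 1) → ℝ) →L[ℝ] (Fin N → ℝ) × (Unit → ℝ) :=
        (ContinuousLinearMap.pi fun i : Fin N => ContinuousLinearMap.proj i.castSucc).prod
          (ContinuousLinearMap.pi fun _ => ContinuousLinearMap.proj (Fin.last N) -
            ∑ i : Fin N, a i • ContinuousLinearMap.proj i.castSucc)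
      convert! (hlaw (N + 1)).map L using 1
      ext ω i <;> simp [L, hY]
    have hind : IndepFun (fun ω (i : Fin N) => X i ω) (fun ω (_ : Unit) => Y ω) P := by
      refine hpair.indepFun_of_covariance_eval (X := fun i : Fin N => X i) (Y := fun _ => Y)
        fun i _ => ?_
      rw [covariance_eq_sub (hLp i) hYLp, hYint, mul_zero, sub_zero, ← ha i]
      simp [hY, mul_comm]
    have hind' : IndepFun (fun ω (i : Fin N) => X i ω) Y P :=
      hind.comp measurable_id (measurable_pi_apply ())
    have hmap := (indepFun_iff_map_prod_eq_prod_map_map (by fun_prop) (by fun_prop)).1 hind'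
    set A : Set (Fin N → ℝ) := {x | ∀ j : Fin N, x j ∈ Set.Icc (u j) (u j + w)}
    have hA : MeasurableSet A := by
      simp only [A, Set.ofPred_forall]
      exact MeasurableSet.iInter fun j => measurable_pi_apply j measurableSet_Icc
    set h : (Fin N → ℝ) → ℝ := fun x => ∑ i, a i * x i
    have hh : Measurable h := by fun_prop
    set B : Set ((Fin N → ℝ) × ℝ) :=
      (Prod.fst ⁻¹' A) ∩ {p | p.2 + h p.1 ∈ Set.Icc (u N) (u N + w)}
    have hB : MeasurableSet B := by
      refine (measurable_fst hA).inter ?_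
      exact (measurable_snd.add (hh.comp measurable_fst)) measurableSet_Icc
    have hset : {ω | ∀ j < N + 1, X j ω ∈ Set.Icc (u j) (u j + w)} =
        (fun ω => (fun i : Fin N => X i ω, Y ω)) ⁻¹' B := by
      ext ω
      simp only [B, A, h, hY, Set.mem_preimage, Set.mem_inter_iff, Set.mem_ofPred_eq,
        Nat.forall_lt_succ_right, sub_add_cancel, Fin.forall_iff]
    have hset' : {ω | ∀ j < N, X j ω ∈ Set.Icc (u j) (u j + w)} =
        (fun ω (i : Fin N) => X i ω) ⁻¹' A := by
      ext ω
      simp only [A, Set.mem_preimage, Set.mem_ofPred_eq, Fin.forall_iff]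
    have ih' := ih fun j hj => hX j (by omega)
    rw [hset', ← Measure.map_apply (by fun_prop) hA] at ih'
    rw [hset, ← Measure.map_apply (by fun_prop) hB, hmap, Measure.prod_apply hB, pow_succ, hv]
    calc _ ≤ ∫⁻ x, A.indicator (fun _ => ENNReal.ofReal (w / σ)) x
            ∂(P.map fun ω (i : Fin N) => X i ω) := by
          refine lintegral_mono fun x => ?_
          by_cases hx : x ∈ A
          · rw [Set.indicator_of_mem hx]
            refine (measure_mono (t := Set.Icc (u N - h x) (u N + w - h x)) ?_).trans
              ((gaussianReal_Icc_le hσ hvar _ _ _).trans_eq ?_)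
            · intro y hy
              have := hy.2
              simp only [Set.mem_ofPred_eq, Set.mem_Icc] at this ⊢
              constructor <;> linarith
            · congr 2; ring
          · rw [Set.indicator_of_notMem hx]
            refine (measure_mono (t := ∅) fun y hy => hx hy.1).trans (by simp)
      _ = ENNReal.ofReal (w / σ) * (P.map fun ω (i : Fin N) => X i ω) A := by
          rw [lintegral_indicator hA, setLIntegral_const]
      _ ≤ _ := by rw [mul_comm]; gcongr

section Polynomial

open Polynomial

theorem coeff_mul_nonneg {p q : ℝ[X]} (hp : ∀ k, 0 ≤ p.coeff k) (hq : ∀ k, 0 ≤ q.coeff k) (k : ℕ) :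
    0 ≤ (p * q).coeff k := by
  rw [coeff_mul]
  exact Finset.sum_nonneg fun _ _ => mul_nonneg (hp _) (hq _)

theorem norm_quadratic_abs_le {a b c : ℝ} (hac : 0 ≤ a * c) {z : ℂ} (hz : z.re ≤ 0) :
    ‖(|a| : ℝ) * z ^ 2 + (|b| : ℝ) * z + (|c| : ℝ)‖ ≤ ‖(a : ℂ) * z ^ 2 + b * z + c‖ := by
  have key : ∀ a b c : ℝ, ‖(a : ℂ) * z ^ 2 + b * z + c‖ ^ 2 =
      (a ^ 2 * (z.re ^ 2 + z.im ^ 2) ^ 2 + 2 * (a * c) * (z.re ^ 2 - z.im ^ 2) + c ^ 2) +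
      b ^ 2 * (z.re ^ 2 + z.im ^ 2) + 2 * z.re * (a * b * (z.re ^ 2 + z.im ^ 2) + b * c) := by
    intro a b c
    rw [← Complex.normSq_eq_norm_sq, Complex.normSq_apply]
    simp [pow_two]
    ring
  refine le_of_sq_le_sq ?_ (norm_nonneg _)
  rw [key, key]
  have h1 : |a| * |c| = a * c := by rw [← abs_mul, abs_of_nonneg hac]
  have h2 : a * b ≤ |a| * |b| := by rw [← abs_mul]; exact le_abs_self _
  have h3 : b * c ≤ |b| * |c| := by rw [← abs_mul]; exact le_abs_self _
  rw [h1, sq_abs, sq_abs, sq_abs]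
  have h4 : a * b * (z.re ^ 2 + z.im ^ 2) + b * c ≤
      |a| * |b| * (z.re ^ 2 + z.im ^ 2) + |b| * |c| := by gcongr
  have := mul_le_mul_of_nonpos_left h4 (show 2 * z.re ≤ 0 by linarith)
  linarith

theorem Irreducible.coeff_two_mul_coeff_zero_nonneg {p : ℝ[X]} (hp : Irreducible p) :
    0 ≤ p.coeff 2 * p.coeff 0 := by
  by_contra! h
  have ha : p.coeff 2 ≠ 0 := by rintro h0; simp [h0] at h
  obtain ⟨x, hx⟩ := exists_quadratic_eq_zero (b := p.coeff 1) (c := p.coeff 0) ha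
    ⟨√(discrim (p.coeff 2) (p.coeff 1) (p.coeff 0)), by
      rw [Real.mul_self_sqrt]
      rw [discrim]
      nlinarith [sq_nonneg (p.coeff 1)]⟩
  have hroot : p.IsRoot x := by
    rw [IsRoot, eq_quadratic_of_degree_le_two hp.degree_le_two]
    simp
    linarith
  have := degree_eq_one_of_irreducible_of_root hp hroot
  exact ha (coeff_eq_zero_of_degree_lt (by rw [this]; norm_num))

theorem exists_nonneg_coeff_norm_aeval_le {p : ℝ[X]} (hp : p ≠ 0) :
    ∃ q : ℝ[X], (∀ k, 0 ≤ q.coeff k) ∧ q.natDegree = p.natDegree ∧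
      q.leadingCoeff = |p.leadingCoeff| ∧
      ∀ z : ℂ, z.re ≤ 0 → ‖aeval z q‖ ≤ ‖aeval z p‖ := by
  induction p using WfDvdMonoid.induction_on_irreducible with
  | zero => exact absurd rfl hp
  | unit u hu =>
    obtain ⟨r, -, rfl⟩ := Polynomial.isUnit_iff.1 hu
    refine ⟨C |r|, fun k => ?_, by simp, by simp, fun z _ => by simp⟩
    rw [coeff_C]
    split_ifs <;> positivity
  | mul a i ha hi ih =>
    obtain ⟨q, hq0, hq1, hq2, hq3⟩ := ih ha
    have hi2 := eq_quadratic_of_degree_le_two hi.degree_le_two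
    set r : ℝ[X] := C |i.coeff 2| * X ^ 2 + C |i.coeff 1| * X + C |i.coeff 0| with hr
    have hrc : ∀ k, r.coeff k = |i.coeff k| := by
      intro k
      conv_rhs => rw [hi2]
      rcases k with _ | _ | _ | k <;> simp [hr, coeff_X, coeff_C]
    have hrd : r.natDegree = i.natDegree := by
      have : r.support = i.support := by
        ext k
        simp [hrc]
      exact natDegree_eq_of_degree_eq (by rw [degree, degree, this])
    have hrl : r.leadingCoeff = |i.leadingCoeff| := by
      rw [leadingCoeff, leadingCoeff, hrd, hrc]
    have hq0' : q ≠ 0 := by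
      rw [← leadingCoeff_ne_zero, hq2]
      simpa using ha
    have hr0 : r ≠ 0 := by
      rw [← leadingCoeff_ne_zero, hrl]
      simpa using hi.ne_zero
    refine ⟨r * q, coeff_mul_nonneg (fun k => by rw [hrc]; positivity) hq0, ?_, ?_, fun z hz => ?_⟩
    · rw [natDegree_mul hr0 hq0', natDegree_mul hi.ne_zero ha, hrd, hq1]
    · rw [leadingCoeff_mul, leadingCoeff_mul, abs_mul, hrl, hq2]
    · rw [map_mul, map_mul, norm_mul, norm_mul]
      refine mul_le_mul ?_ (hq3 z hz) (norm_nonneg _) (norm_nonneg _)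
      have := norm_quadratic_abs_le (b := i.coeff 1) hi.coeff_two_mul_coeff_zero_nonneg hz
      rw [hi2]
      simpa [hr] using this

theorem coeff_mul_geom_sum {r : ℝ[X]} {d L k : ℕ} (hr : r.natDegree ≤ d) (hd : d ≤ k) (hk : k ≤ L) :
    (r * ∑ i ∈ Finset.range (L + 1), X ^ i).coeff k = r.eval 1 := by
  rw [coeff_mul, Finset.Nat.sum_antidiagonal_eq_sum_range_succ
    (fun i j => r.coeff i * (∑ i ∈ Finset.range (L + 1), (X : ℝ[X]) ^ i).coeff j),
    eval_eq_sum_range' (n := k + 1) (by omega)]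
  refine Finset.sum_congr rfl fun i hi => ?_
  have : k - i < L + 1 := by omega
  simp [finsetSum_coeff, coeff_X_pow, this]

/-- A monic polynomial can be multiplied by a polynomial of small modulus on the left half of the
unit circle so as to obtain the generating function of a probability distribution, uniform on a long
interval. -/
theorem exists_averaging_polynomial {p : ℝ[X]} {m : ℕ} (hp : p.Monic) (hm : p.natDegree = m) :
    ∃ Q : ℝ[X], (∀ k, 0 ≤ Q.coeff k) ∧ Q.natDegree ≤ 5 * m ∧ Q.eval 1 = 1 ∧
      (∀ k, 2 * m ≤ k → k ≤ 3 * m → Q.coeff k = 1 / (3 * m + 1)) ∧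
      ∀ z : ℂ, ‖z‖ = 1 → z.re ≤ 0 → ‖aeval z Q‖ ^ 2 ≤ (1 / 2) ^ m * ‖aeval z p‖ ^ 2 := by
  obtain ⟨q, hq0, hq1, hq2, hq3⟩ := exists_nonneg_coeff_norm_aeval_le hp.ne_zero
  rw [hp.leadingCoeff, abs_one] at hq2
  have hq1' : 1 ≤ q.eval 1 := by
    have h : q.coeff q.natDegree * 1 ^ q.natDegree = 1 := by rw [one_pow, mul_one]; exact hq2
    rw [eval_eq_sum_range]
    exact h.symm.trans_le (Finset.single_le_sum (f := fun i => q.coeff i * 1 ^ i)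
      (fun i _ => by simpa using hq0 i) (Finset.self_mem_range_succ _))
  set r : ℝ[X] := q * (X + 1) ^ m with hr
  set G : ℝ[X] := ∑ i ∈ Finset.range (3 * m + 1), X ^ i with hG
  have hrd : r.natDegree ≤ 2 * m := by
    have h1 : ((X + 1 : ℝ[X]) ^ m).natDegree ≤ m := by
      have := natDegree_X_add_C (1 : ℝ)
      rw [C_1] at this
      simp [this]
    have := natDegree_mul_le (p := q) (q := (X + 1) ^ m)
    rw [← hr] at this
    omega
  have hGd : G.natDegree ≤ 3 * m := by
    refine natDegree_sum_le_of_forall_le _ _ fun i hi => ?_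
    rw [natDegree_X_pow]
    simp at hi
    omega
  have hr1 : r.eval 1 = q.eval 1 * 2 ^ m := by simp [hr]; norm_num
  have hr0 : 0 < r.eval 1 := by rw [hr1]; positivity
  have hG1 : G.eval 1 = 3 * m + 1 := by simp [hG, eval_finsetSum]
  have hr2 : ∀ k, 0 ≤ r.coeff k := by
    refine coeff_mul_nonneg hq0 fun k => ?_
    rw [coeff_X_add_one_pow]
    positivity
  have hG2 : ∀ k, 0 ≤ G.coeff k := fun k => by
    rw [hG, finsetSum_coeff]
    exact Finset.sum_nonneg fun i _ => by rw [coeff_X_pow]; split_ifs <;> simp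
  set κ : ℝ := (r.eval 1 * (3 * m + 1))⁻¹ with hκ
  have hκ0 : 0 < κ := by positivity
  refine ⟨C κ * (r * G), fun k => ?_, ?_, ?_, fun k hk1 hk2 => ?_, fun z hz hz' => ?_⟩
  · rw [coeff_C_mul]
    exact mul_nonneg hκ0.le (coeff_mul_nonneg hr2 hG2 k)
  · refine (natDegree_C_mul_le _ _).trans (natDegree_mul_le.trans ?_)
    omega
  · rw [eval_C_mul, eval_mul, hG1, hκ, inv_mul_cancel₀ (by positivity)]
  · rw [coeff_C_mul, coeff_mul_geom_sum hrd hk1 hk2, hκ]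
    field_simp
  · have h1 : ‖z + 1‖ ^ 2 ≤ 2 := by
      have h := hz
      rw [← sq_eq_sq₀ (norm_nonneg _) zero_le_one, ← Complex.normSq_eq_norm_sq,
        Complex.normSq_apply] at h
      rw [← Complex.normSq_eq_norm_sq, Complex.normSq_apply]
      simp
      linarith
    have h2 : ‖aeval z G‖ ≤ 3 * m + 1 := by
      rw [hG, map_sum]
      refine (norm_sum_le _ _).trans ?_
      simp [hz]
    have h3 : κ * 2 ^ m * (3 * m + 1) ≤ 1 := by
      rw [hκ, hr1]
      rw [inv_mul_eq_div, div_mul_eq_mul_div, div_le_one (by positivity)]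
      nlinarith [show (0 : ℝ) < 2 ^ m * (3 * m + 1) by positivity]
    have h4 : ‖aeval z (C κ * (r * G))‖ = κ * ‖aeval z q‖ * ‖z + 1‖ ^ m * ‖aeval z G‖ := by
      simp [hr, abs_of_pos hκ0]
      ring
    have h5 : (‖z + 1‖ ^ m) ^ 2 ≤ (1 / 2) ^ m * (2 ^ m) ^ 2 := by
      rw [← pow_mul, ← pow_mul, mul_comm m 2, pow_mul, pow_mul, ← mul_pow]
      gcongr
      norm_num
      exact h1
    rw [h4]
    calc _ = κ ^ 2 * ‖aeval z q‖ ^ 2 * (‖z + 1‖ ^ m) ^ 2 * ‖aeval z G‖ ^ 2 := by ring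
      _ ≤ κ ^ 2 * ‖aeval z p‖ ^ 2 * ((1 / 2) ^ m * (2 ^ m) ^ 2) * (3 * m + 1) ^ 2 := by
        gcongr
        exact hq3 z hz'
      _ = (κ * 2 ^ m * (3 * m + 1)) ^ 2 * ((1 / 2) ^ m * ‖aeval z p‖ ^ 2) := by ring
      _ ≤ 1 ^ 2 * ((1 / 2) ^ m * ‖aeval z p‖ ^ 2) := by gcongr
      _ = _ := by ring

end Polynomial

theorem norm_sum_mul_exp_pow_sq {N : ℕ} (a : Fin N → ℝ) (y : ℝ) :
    ‖∑ i, (a i : ℂ) * Complex.exp (2 * π * y * Complex.I) ^ (i : ℕ)‖ ^ 2 =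
      ∑ i, ∑ j, a i * a j * Real.cos (2 * π * ((i : ℕ) - (j : ℕ)) * y) := by
  have h : ∀ i : Fin N, (a i : ℂ) * Complex.exp (2 * π * y * Complex.I) ^ (i : ℕ) =
      (a i * Real.cos (2 * π * (i : ℕ) * y) : ℝ) +
        (a i * Real.sin (2 * π * (i : ℕ) * y) : ℝ) * Complex.I := by
    intro i
    rw [← Complex.exp_nat_mul, show ((i : ℕ) : ℂ) * (2 * π * y * Complex.I) =
      ((2 * π * (i : ℕ) * y : ℝ) : ℂ) * Complex.I by push_cast; ring, Complex.exp_mul_I]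
    push_cast
    ring
  rw [Finset.sum_congr rfl fun i _ => h i, Finset.sum_add_distrib, ← Finset.sum_mul,
    ← Complex.ofReal_sum, ← Complex.ofReal_sum, ← Complex.normSq_eq_norm_sq,
    Complex.normSq_add_mul_I, pow_two, pow_two, Finset.sum_mul_sum, Finset.sum_mul_sum,
    ← Finset.sum_add_distrib]
  refine Finset.sum_congr rfl fun i _ => ?_
  rw [← Finset.sum_add_distrib]
  refine Finset.sum_congr rfl fun j _ => ?_
  rw [mul_sub, sub_mul, Real.cos_sub]
  ring

section Spectral

variable {Ω : Type*} {mΩ : MeasurableSpace Ω} {P : Measure Ω} {μ : Measure ℝ} [IsFiniteMeasure μ]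
  {X : ℕ → Ω → ℝ}

theorem integral_sum_mul_sq_eq (hX : ∀ i, MemLp (X i) 2 P)
    (hcov : ∀ i j : ℕ, ∫ ω, X i ω * X j ω ∂P = ∫ y, Real.cos (2 * π * ((i : ℝ) - j) * y) ∂μ)
    {N : ℕ} (a : Fin N → ℝ) :
    ∫ ω, (∑ i, a i * X i ω) ^ 2 ∂P =
      ∫ y, ‖∑ i, (a i : ℂ) * Complex.exp (2 * π * y * Complex.I) ^ (i : ℕ)‖ ^ 2 ∂μ := by
  have hI : ∀ i j : Fin N, Integrable (fun ω => a i * a j * (X i ω * X j ω)) P := fun i j =>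
    ((hX i).integrable_mul (hX j)).const_mul _
  have hJ : ∀ i j : Fin N, Integrable
      (fun y => a i * a j * Real.cos (2 * π * ((i : ℕ) - (j : ℕ)) * y)) μ := fun i j =>
    Integrable.const_mul (.of_bound (C := 1) (by fun_prop)
      (.of_forall fun y => by simpa using Real.abs_cos_le_one _)) _
  have h : ∀ ω, (∑ i, a i * X i ω) ^ 2 = ∑ i, ∑ j, a i * a j * (X i ω * X j ω) := fun ω => by
    rw [pow_two, Finset.sum_mul_sum]
    exact Finset.sum_congr rfl fun i _ => Finset.sum_congr rfl fun j _ => by ring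
  simp only [h, norm_sum_mul_exp_pow_sq]
  rw [integral_finsetSum _ fun i _ => integrable_finsetSum _ fun j _ => hI i j,
    integral_finsetSum _ fun i _ => integrable_finsetSum _ fun j _ => hJ i j]
  refine Finset.sum_congr rfl fun i _ => ?_
  rw [integral_finsetSum _ fun j _ => hI i j, integral_finsetSum _ fun j _ => hJ i j]
  refine Finset.sum_congr rfl fun j _ => ?_
  rw [integral_const_mul, integral_const_mul, hcov]

open Polynomial in
theorem integral_sum_coeff_mul_sq_eq (hX : ∀ i, MemLp (X i) 2 P)
    (hcov : ∀ i j : ℕ, ∫ ω, X i ω * X j ω ∂P = ∫ y, Real.cos (2 * π * ((i : ℝ) - j) * y) ∂μ)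
    {N : ℕ} {p : ℝ[X]} (hp : p.natDegree < N) :
    ∫ ω, (∑ i : Fin N, p.coeff i * X i ω) ^ 2 ∂P =
      ∫ y, ‖aeval (Complex.exp (2 * π * y * Complex.I)) p‖ ^ 2 ∂μ := by
  rw [integral_sum_mul_sq_eq hX hcov]
  simp only [aeval_eq_sum_range' hp, Finset.sum_range, Complex.real_smul]

open Polynomial in
theorem exists_monic_integral_sub_sum_sq_eq (hX : ∀ i, MemLp (X i) 2 P)
    (hcov : ∀ i j : ℕ, ∫ ω, X i ω * X j ω ∂P = ∫ y, Real.cos (2 * π * ((i : ℝ) - j) * y) ∂μ)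
    {m : ℕ} (a : Fin m → ℝ) :
    ∃ p : ℝ[X], p.Monic ∧ p.natDegree = m ∧
      ∫ ω, (X m ω - ∑ i, a i * X i ω) ^ 2 ∂P =
        ∫ y, ‖aeval (Complex.exp (2 * π * y * Complex.I)) p‖ ^ 2 ∂μ := by
  set p : ℝ[X] := Polynomial.X ^ m + ∑ i : Fin m, C (-a i) * Polynomial.X ^ (i : ℕ) with hp
  have hlt := degree_sum_fin_lt fun i : Fin m => -a i
  have hpm : p.Monic := monic_X_pow_add hlt
  have hpd : p.natDegree = m := by
    rw [hp, natDegree_add_eq_left_of_degree_lt (by rwa [degree_X_pow]), natDegree_X_pow]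
  have hpc : ∀ i : Fin m, p.coeff i = -a i := fun i => by
    simp [hp, finsetSum_coeff, coeff_X_pow, Fin.val_inj, i.2.ne]
  have hm : p.coeff m = 1 := hpd ▸ hpm
  refine ⟨p, hpm, hpd, ?_⟩
  rw [← integral_sum_coeff_mul_sq_eq hX hcov (N := m + 1) (by omega)]
  simp only [Fin.sum_univ_castSucc, Fin.val_castSucc, hpc, Fin.val_last, hm]
  refine integral_congr_ae (.of_forall fun ω => ?_)
  simp only [neg_mul, Finset.sum_neg_distrib]
  ring

open Polynomial in
theorem exists_monic_forall_integral_le (hX : ∀ i, MemLp (X i) 2 P)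
    (hcov : ∀ i j : ℕ, ∫ ω, X i ω * X j ω ∂P = ∫ y, Real.cos (2 * π * ((i : ℝ) - j) * y) ∂μ)
    (m : ℕ) :
    ∃ p : ℝ[X], p.Monic ∧ p.natDegree = m ∧ ∀ q : ℝ[X], q.Monic → q.natDegree ≤ m →
      ∫ y, ‖aeval (Complex.exp (2 * π * y * Complex.I)) p‖ ^ 2 ∂μ ≤
        ∫ y, ‖aeval (Complex.exp (2 * π * y * Complex.I)) q‖ ^ 2 ∂μ := by
  obtain ⟨a, ha⟩ := exists_forall_integral_sub_sum_sq_le hX m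
  obtain ⟨p, hpm, hpd, hp⟩ := exists_monic_integral_sub_sum_sq_eq hX hcov a
  refine ⟨p, hpm, hpd, fun q hq hqd => ?_⟩
  have hshift : ∫ y, ‖aeval (Complex.exp (2 * π * y * Complex.I)) q‖ ^ 2 ∂μ =
      ∫ y, ‖aeval (Complex.exp (2 * π * y * Complex.I))
        (q * Polynomial.X ^ (m - q.natDegree))‖ ^ 2 ∂μ := by
    refine integral_congr_ae (.of_forall fun y => ?_)
    have : ‖Complex.exp (2 * π * y * Complex.I)‖ = 1 := by
      have := Complex.norm_exp_ofReal_mul_I (2 * π * y)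
      push_cast at this
      exact this
    simp [this]
  have hrm := hq.mul (monic_X_pow (R := ℝ) (m - q.natDegree))
  have hrd : (q * Polynomial.X ^ (m - q.natDegree)).natDegree = m := by
    rw [hq.natDegree_mul (monic_X_pow _), natDegree_X_pow]
    omega
  set r := q * Polynomial.X ^ (m - q.natDegree)
  have hr : r.coeff m = 1 := by rw [← hrd]; exact hrm
  rw [hshift, ← hp, ← integral_sum_coeff_mul_sq_eq hX hcov (N := m + 1) (by omega)]
  refine (ha fun i => -r.coeff i).trans_eq (integral_congr_ae (.of_forall fun ω => ?_))
  simp [Fin.sum_univ_castSucc, hr, add_comm]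

end Spectral

theorem half_pow_div_five_le {n : ℕ} (hn : 80000 ≤ n) :
    (1 / 2 : ℝ) ^ (n / 5) ≤ Real.exp (-6 * (1 / 100) * n) := by
  have h : (n : ℝ) ≤ 10 * (n / 5 : ℕ) := by exact_mod_cast (by omega : n ≤ 10 * (n / 5))
  have h2 : (1 / 2 : ℝ) = Real.exp (-Real.log 2) := by
    rw [Real.exp_neg, Real.exp_log two_pos, one_div]
  rw [h2, ← Real.exp_nat_mul]
  apply Real.exp_le_exp.2
  nlinarith [Real.log_two_gt_d9]

theorem exp_mul_pow_le {n : ℕ} (hn : 80000 ≤ n) :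
    (Real.exp (-(1 / 100) * n) * (3 * (n / 5 : ℕ) + 1)) ^ (n / 5 + 1) ≤
      Real.exp (-(1 / 1000) * (n : ℝ) ^ 2) := by
  have hn' : (80000 : ℝ) ≤ n := by exact_mod_cast hn
  have h1 : (3 * (n / 5 : ℕ) + 1 : ℝ) ≤ n := by exact_mod_cast (by omega : 3 * (n / 5) + 1 ≤ n)
  have h2 : (n : ℝ) ≤ 5 * ((n / 5 : ℕ) + 1) := by
    exact_mod_cast (by omega : n ≤ 5 * (n / 5 + 1))
  have h3 : (n : ℝ) ≤ Real.exp (n / 200) := by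
    have := Real.quadratic_le_exp_of_nonneg (x := n / 200) (by positivity)
    nlinarith
  have h4 : Real.exp (-(1 / 100) * n) * (3 * (n / 5 : ℕ) + 1) ≤ Real.exp (-(n / 200)) := by
    calc _ ≤ Real.exp (-(1 / 100) * n) * Real.exp (n / 200) := by gcongr; linarith
      _ = _ := by rw [← Real.exp_add]; congr 1; ring
  calc _ ≤ Real.exp (-(n / 200)) ^ (n / 5 + 1) := by gcongr
    _ = Real.exp ((n / 5 + 1 : ℕ) * (-(n / 200))) := by rw [← Real.exp_nat_mul]
    _ ≤ _ := by
      apply Real.exp_le_exp.2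
      push_cast
      nlinarith

/-- **Main Lemma.** There exist `n₀ ∈ ℕ` and `c, c' > 0` such that if `f` is a
centered continuous stationary Gaussian process on `ℝ` whose spectral measure `μ` is supported
on `[-1/2, 1/2] \ (-1/4, 1/4)`, then for every `n ≥ n₀` there are `σ ∈ [0, √μ(ℝ)]` and
nonnegative weights `β₀, …, β_n` summing to `1` with
`E[(∑ β_k f(k))²] ≤ e^{-6cn} σ²` and, for every deterministic `φ : ℝ → ℝ`,
`P{f + φ ≥ 0 on supp β, ∑ β_k (f(k) + φ(k)) ≤ e^{-cn} σ} ≤ e^{-c'n²}`. -/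
theorem main_lemma_spectral_annulus :
    ∃ (n₀ : ℕ) (c c' : ℝ), 0 < c ∧ 0 < c' ∧
      ∀ (Ω : Type) (_ : MeasurableSpace Ω) (P : Measure Ω), IsProbabilityMeasure P →
      ∀ (μ : Measure ℝ), IsFiniteMeasure μ → μ ≠ 0 →
      (∀ E : Set ℝ, MeasurableSet E → μ ((fun x : ℝ => -x) ⁻¹' E) = μ E) →
      μ (Set.Icc (-(1/2 : ℝ)) (1/2) \ Set.Ioo (-(1/4 : ℝ)) (1/4))ᶜ = 0 →
      ∀ (f : ℝ → Ω → ℝ),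
      Measurable (fun p : ℝ × Ω => f p.1 p.2) →
      (∀ (m : ℕ) (x : Fin m → ℝ) (a : Fin m → ℝ), ∃ v : ℝ≥0,
        P.map (fun ω => ∑ i, a i * f (x i) ω) = gaussianReal 0 v) →
      (∀ᵐ ω ∂P, Continuous fun x => f x ω) →
      (∀ s t : ℝ, ∫ ω, f s ω * f t ω ∂P = ∫ y, Real.cos (2 * π * (s - t) * y) ∂μ) →
      ∀ n : ℕ, n₀ ≤ n →
        ∃ (σ : ℝ) (β : Fin (n + 1) → ℝ),
          σ ∈ Set.Icc 0 (Real.sqrt (μ Set.univ).toReal) ∧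
          (∀ k, 0 ≤ β k) ∧ (∑ k, β k) = 1 ∧
          (∫ ω, (∑ k, β k * f (k : ℕ) ω) ^ 2 ∂P ≤ Real.exp (-6 * c * n) * σ ^ 2) ∧
          (∀ φ : ℝ → ℝ,
            P {ω | (∀ k : Fin (n + 1), 0 < β k → 0 ≤ f (k : ℕ) ω + φ (k : ℕ)) ∧
                ∑ k, β k * (f (k : ℕ) ω + φ (k : ℕ)) ≤ Real.exp (-c * n) * σ} ≤
              ENNReal.ofReal (Real.exp (-c' * (n : ℝ) ^ 2))) := by
  refine ⟨80000, 1 / 100, 1 / 1000, by norm_num, by norm_num, ?_⟩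
  intro Ω _ P _ μ _ hμ0 _ hsupp f hf hgauss _ hcov n hn
  have hfm : ∀ t, Measurable (f t) := fun t => hf.comp measurable_prodMk_left
  have hfLp : ∀ t, MemLp (f t) 2 P := fun t => by
    obtain ⟨v, hv⟩ := hgauss 1 (fun _ => t) (fun _ => 1)
    have hv' : P.map (f t) = gaussianReal 0 v := by simpa using hv
    have := memLp_id_gaussianReal' (μ := 0) (v := v) 2 (by simp)
    rw [← hv'] at this
    exact this.comp_of_map (hfm t).aemeasurable
  set m := n / 5 with hm
  have hcovs : ∀ s i j : ℕ, ∫ ω, f ((s + i : ℕ) : ℝ) ω * f ((s + j : ℕ) : ℝ) ω ∂P =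
      ∫ y, Real.cos (2 * π * ((i : ℝ) - j) * y) ∂μ := fun s i j => by
    rw [hcov]
    push_cast
    simp only [add_sub_add_left_eq_sub]
  set X : ℕ → Ω → ℝ := fun j => f ((2 * m + j : ℕ) : ℝ) with hXdef
  have hXm : ∀ j, Measurable (X j) := fun j => hfm _
  have hXLp : ∀ j, MemLp (X j) 2 P := fun j => hfLp _
  have hXG : ∀ (N : ℕ) (a : Fin N → ℝ), ∃ v : ℝ≥0,
      P.map (fun ω => ∑ i, a i * X i ω) = gaussianReal 0 v := fun N a =>
    hgauss N (fun i => ((2 * m + i : ℕ) : ℝ)) a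
  obtain ⟨p, hpm, hpd, hpmin⟩ := exists_monic_forall_integral_le hXLp (hcovs (2 * m)) m
  obtain ⟨Q, hQ0, hQd, hQ1, hQc, hQz⟩ := exists_averaging_polynomial hpm hpd
  set I : Polynomial ℝ → ℝ := fun q =>
    ∫ y, ‖Polynomial.aeval (Complex.exp (2 * π * y * Complex.I)) q‖ ^ 2 ∂μ with hI
  have hIp : 0 ≤ I p := integral_nonneg fun y => by positivity
  set σ := √(I p) with hσ
  have hσ2 : σ ^ 2 = I p := Real.sq_sqrt hIp
  have hI1 : I 1 = (μ Set.univ).toReal := by simp [hI, measureReal_def]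
  have hQd' : Q.natDegree < n + 1 := by omega
  refine ⟨σ, fun k => Q.coeff k, ⟨Real.sqrt_nonneg _, ?_⟩, fun k => hQ0 k, ?_, ?_, fun φ => ?_⟩
  · rw [← hI1]
    exact Real.sqrt_le_sqrt (hpmin 1 Polynomial.monic_one (by simp))
  · rw [← hQ1, Polynomial.eval_eq_sum_range' hQd', Finset.sum_range]
    simp
  · have h0 := integral_sum_coeff_mul_sq_eq (X := fun j : ℕ => f (j : ℝ)) (fun j => hfLp _)
      (fun i j => by simpa using hcovs 0 i j) hQd'
    rw [h0, hσ2]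
    have hcont : ∀ q : Polynomial ℝ, Integrable (fun y : ℝ =>
        ‖Polynomial.aeval (Complex.exp (2 * π * y * Complex.I)) q‖ ^ 2) μ := fun q => by
      refine .of_bound (C := (∑ i ∈ Finset.range (q.natDegree + 1), |q.coeff i|) ^ 2) ?_ (.of_forall fun y => ?_)
      · refine Continuous.aestronglyMeasurable ?_
        fun_prop
      · rw [Real.norm_of_nonneg (by positivity), Polynomial.aeval_eq_sum_range]
        have hno := Complex.norm_exp_ofReal_mul_I (2 * π * y)
        push_cast at hno
        gcongr
        refine (norm_sum_le _ _).trans_eq ?_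
        simp [hno]
    calc _ ≤ ∫ y, (1 / 2) ^ m *
          ‖Polynomial.aeval (Complex.exp (2 * π * y * Complex.I)) p‖ ^ 2 ∂μ := by
          refine integral_mono_ae (hcont Q) ((hcont p).const_mul _) ?_
          filter_upwards [mem_ae_iff.2 hsupp] with y hy
          have hre := Complex.exp_ofReal_mul_I_re (2 * π * y)
          have hno := Complex.norm_exp_ofReal_mul_I (2 * π * y)
          push_cast at hre hno
          refine hQz _ hno ?_
          rw [hre, ← Real.cos_abs]
          obtain ⟨⟨h1, h2⟩, h3⟩ := hy
          have h4 : 1 / 4 ≤ |y| := by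
            by_contra! h
            exact h3 (abs_lt.1 h)
          have h5 : |y| ≤ 1 / 2 := abs_le.2 ⟨h1, h2⟩
          rw [abs_mul, abs_of_pos Real.two_pi_pos]
          apply Real.cos_nonpos_of_pi_div_two_le_of_le <;> nlinarith [Real.pi_pos]
      _ = (1 / 2) ^ m * I p := integral_const_mul _ _
      _ ≤ _ := by
          gcongr
          exact half_pow_div_five_le hn
  · have hsub : {ω | (∀ k : Fin (n + 1), 0 < Q.coeff k → 0 ≤ f (k : ℕ) ω + φ (k : ℕ)) ∧
        ∑ k : Fin (n + 1), Q.coeff k * (f (k : ℕ) ω + φ (k : ℕ)) ≤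
          Real.exp (-(1 / 100) * n) * σ} ⊆
        {ω | ∀ j < m + 1, X j ω ∈ Set.Icc (-φ (2 * m + j : ℕ))
          (-φ (2 * m + j : ℕ) + Real.exp (-(1 / 100) * n) * σ * (3 * m + 1))} := by
      rintro ω ⟨h1, h2⟩ j hj
      have hnn : ∀ k : Fin (n + 1), 0 ≤ Q.coeff k * (f (k : ℕ) ω + φ (k : ℕ)) := fun k => by
        rcases (hQ0 k).eq_or_lt with h | h
        · rw [← h, zero_mul]
        · exact mul_nonneg h.le (h1 k h)
      have hk : 2 * m + j < n + 1 := by omega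
      have hc := hQc (2 * m + j) (by omega) (by omega)
      have h3 := h1 ⟨2 * m + j, hk⟩ (by rw [hc]; positivity)
      have h4 := (Finset.single_le_sum (fun k _ => hnn k)
        (Finset.mem_univ (⟨2 * m + j, hk⟩ : Fin (n + 1)))).trans h2
      simp only at h3 h4
      rw [hc, one_div_mul_eq_div, div_le_iff₀ (by positivity)] at h4
      constructor <;> simp only [hXdef] <;> linarith
    refine (measure_mono hsub).trans ?_
    rcases (Real.sqrt_nonneg (I p)).eq_or_lt with h0 | hpos
    · rw [← hσ] at h0
      have hμpos : 0 < (μ Set.univ).toReal :=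
        ENNReal.toReal_pos (by simpa using hμ0) (measure_ne_top _ _)
      have := measure_forall_mem_Icc_le hXm hXG (σ := √(μ Set.univ).toReal) (w := 0) (N := 1)
        (Real.sqrt_pos.2 hμpos) (fun j hj a => by
          obtain rfl : j = 0 := by omega
          rw [Real.sq_sqrt hμpos.le]
          have := hcovs (2 * m) 0 0
          simp [hXdef, measureReal_def] at this ⊢
          rw [← this]
          simp [pow_two]) (fun j => -φ (2 * m + j : ℕ))
      refine (measure_mono ?_).trans (this.trans (by simp))
      intro ω hω j hj
      have := hω j (by omega)
      rw [← h0] at this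
      simpa using this
    · rw [← hσ] at hpos
      refine (measure_forall_mem_Icc_le hXm hXG hpos (fun j hj b => ?_) _).trans ?_
      · obtain ⟨q, hqm, hqd, hq⟩ := exists_monic_integral_sub_sum_sq_eq hXLp (hcovs (2 * m)) b
        rw [hσ2, hq]
        exact hpmin q hqm (by omega)
      · rw [← ENNReal.ofReal_pow (by positivity)]
        refine ENNReal.ofReal_le_ofReal (le_of_eq_of_le ?_ (exp_mul_pow_le hn))
        congr 1
        field_simp
        rfl
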